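/- arXiv:1601.07736 — 2 statements merged into one kernel-verified Lean document; each statement's English description precedes it below -/
import Mathlib

section
/- Let S = [s_{ij}] be an n×n row-stochastic matrix, and for each i let S_i = max_{j ≠ i} s_{ji} be the maximal element among the off-diagonal entries of the i-th column of S. Set γ' = max_{1 ≤ i ≤ n} (S_i − s_{ii}). Then every eigenvalue λ of S with λ ≠ 1 satisfies |λ + γ'| ≤ trace(S) + (n−1)γ' − 1. -/
/-- An eigenvalue of a square matrix over a field with respect to column vectors is also an eigenvalue
with respect to row vectors. -/
theorem Matrix.exists_vecMul_eq_smul_of_mulVec_eq_smul {ι K : Type*} [Fintype ι] [DecidableEq ι]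
    [Field K] {A : Matrix ι ι K} {c : K} (h : ∃ v : ι → K, v ≠ 0 ∧ A.mulVec v = c • v) :
    ∃ w : ι → K, w ≠ 0 ∧ Matrix.vecMul w A = c • w := by
  obtain ⟨v, hv, hAv⟩ := h
  have hdet : (A - c • (1 : Matrix ι ι K)).det = 0 :=
    Matrix.exists_mulVec_eq_zero_iff.mp
      ⟨v, hv, by rw [Matrix.sub_mulVec, hAv, Matrix.smul_mulVec, Matrix.one_mulVec, sub_self]⟩
  obtain ⟨w, hw, hwA⟩ := Matrix.exists_vecMul_eq_zero_iff.mpr hdet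
  refine ⟨w, hw, ?_⟩
  rwa [Matrix.vecMul_sub, Matrix.vecMul_smul, Matrix.vecMul_one, sub_eq_zero] at hwA

/-- A complex eigenvalue of a nonnegative matrix with constant row sum `r` has modulus at
most `r`. -/
theorem Matrix.norm_le_of_vecMul_eq_smul_of_row_sum {ι : Type*} [Fintype ι]
    {B : Matrix ι ι ℝ} (hB : ∀ i j, 0 ≤ B i j) {r : ℝ} (hr : ∀ i, ∑ j, B i j = r)
    {c : ℂ} {w : ι → ℂ} (hw : w ≠ 0) (h : ∀ j, ∑ i, w i * (B i j : ℂ) = c * w j) :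
    ‖c‖ ≤ r := by
  have hpos : 0 < ∑ i, ‖w i‖ := by
    obtain ⟨i, hi⟩ := Function.ne_iff.mp hw
    exact Finset.sum_pos' (fun _ _ => norm_nonneg _) ⟨i, Finset.mem_univ i, norm_pos_iff.mpr hi⟩
  refine le_of_mul_le_mul_right ?_ hpos
  calc ‖c‖ * ∑ j, ‖w j‖ = ∑ j, ‖∑ i, w i * (B i j : ℂ)‖ := by
        simp only [h, norm_mul, Finset.mul_sum]
    _ ≤ ∑ j, ∑ i, ‖w i‖ * B i j := by
        refine Finset.sum_le_sum fun j _ => (norm_sum_le _ _).trans_eq ?_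
        refine Finset.sum_congr rfl fun i _ => ?_
        rw [norm_mul, Complex.norm_real, Real.norm_of_nonneg (hB i j)]
    _ = r * ∑ i, ‖w i‖ := by
        rw [Finset.sum_comm, Finset.mul_sum]
        refine Finset.sum_congr rfl fun i _ => ?_
        rw [← Finset.mul_sum, hr, mul_comm]

/-- A row eigenvector of a matrix with unit row sums, for an eigenvalue other than `1`, has
coordinate sum zero. -/
theorem Matrix.sum_eq_zero_of_vecMul_eq_smul {ι K : Type*} [Fintype ι] [Field K]
    {A : Matrix ι ι K} (hrow : ∀ i, ∑ j, A i j = 1) {c : K} (hc : c ≠ 1) {w : ι → K}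
    (h : ∀ j, ∑ i, w i * A i j = c * w j) : ∑ i, w i = 0 := by
  have hsum : c * ∑ i, w i = ∑ i, w i := by
    simp only [Finset.mul_sum, ← h]
    rw [Finset.sum_comm]
    simp only [← Finset.mul_sum, hrow, mul_one]
  have : (c - 1) * ∑ i, w i = 0 := by rw [sub_mul, hsum, one_mul, sub_self]
  exact (mul_eq_zero.mp this).resolve_left (sub_ne_zero.mpr hc)

/-- Li and Li: Let `S` be an `n×n` row-stochastic matrix, let
`Smax i = max_{j ≠ i} S j i` be the maximal off-diagonal entry of the `i`-th column,
and `γ' = max_i (Smax i - S i i)`. Then every complex eigenvalue `λ ≠ 1` of `S`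
satisfies `|λ + γ'| ≤ trace S + (n - 1) γ' - 1`. -/
theorem lili_eigenvalue_disc (n : ℕ)
    (S : Matrix (Fin n) (Fin n) ℝ)
    (hnonneg : ∀ i j, 0 ≤ S i j)
    (hrow : ∀ i, ∑ j, S i j = 1)
    (Smax : Fin n → ℝ) (hSmax : ∀ i, Smax i = ⨆ j : {j : Fin n // j ≠ i}, S j i)
    (γ' : ℝ) (hγ' : γ' = ⨆ i : Fin n, (Smax i - S i i))
    (lam : ℂ) (hlam : lam ≠ 1)
    (hev : ∃ v : Fin n → ℂ, v ≠ 0 ∧ (S.map (fun x => (x : ℂ))).mulVec v = lam • v) :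
    ‖lam + (γ' : ℂ)‖ ≤ Matrix.trace S + ((n : ℝ) - 1) * γ' - 1 := by
  obtain ⟨w, hw, hwS⟩ := Matrix.exists_vecMul_eq_smul_of_mulVec_eq_smul hev
  have hwS' (j : Fin n) : ∑ i, w i * (S i j : ℂ) = lam * w j := by
    simpa [Matrix.vecMul, dotProduct] using congrFun hwS j
  have hw0 : ∑ i, w i = 0 :=
    Matrix.sum_eq_zero_of_vecMul_eq_smul (A := S.map (fun x => (x : ℂ)))
      (fun i => by simpa using congrArg (fun x : ℝ => (x : ℂ)) (hrow i)) hlam hwS'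
  have hle (i j : Fin n) (hij : i ≠ j) : S i j ≤ S j j + γ' := by
    have hcol : S i j ≤ Smax j := by
      rw [hSmax]
      exact le_ciSup (f := fun k : {k : Fin n // k ≠ j} => S k j)
        (Set.finite_range _).bddAbove ⟨i, hij⟩
    have hmax : Smax j - S j j ≤ γ' := by
      rw [hγ']
      exact le_ciSup (f := fun k => Smax k - S k k) (Set.finite_range _).bddAbove j
    linarith
  let B : Matrix (Fin n) (Fin n) ℝ :=
    Matrix.of fun i j => S j j + γ' - S i j - if i = j then γ' else 0
  rw [← norm_neg]
  refine Matrix.norm_le_of_vecMul_eq_smul_of_row_sum (B := B) ?_ ?_ hw ?_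
  · intro i j
    by_cases hij : i = j
    · simp [B, hij]
    · simpa [B, hij] using hle i j hij
  · intro i
    simp only [B, Matrix.of_apply, Finset.sum_sub_distrib, Finset.sum_add_distrib, hrow,
      Finset.sum_ite_eq, Finset.mem_univ, if_true, Finset.sum_const, Finset.card_univ,
      Fintype.card_fin, nsmul_eq_mul, Matrix.trace, Matrix.diag_apply]
    ring
  · intro j
    have hdiag : ∑ i, w i * ((if i = j then γ' else 0 : ℝ) : ℂ) = w j * γ' := by
      simp [apply_ite (fun x : ℝ => (x : ℂ))]
    simp only [B, Matrix.of_apply, Complex.ofReal_sub, mul_sub, Finset.sum_sub_distrib,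
      ← Finset.sum_mul, hw0, hwS', hdiag]
    ring
end

section
/- Let Γ be a simple connected graph on n vertices with Randić transition matrix 𝓡 = [r_{ij}] where r_{ij} = 1/d_i if i ∼ j and 0 otherwise. If i and k are distinct non-adjacent vertices (k ≁ i), then Σ_{j ≠ i, j ≠ k} |r_{kj} − r_{ij}| = 2 − 2N(i,k)/max{d_i, d_k}. -/
/-- The entries `1 / d_i` over the neighbours of a non-isolated vertex sum to `1`. -/
theorem sum_one_div_degree_eq_one {V : Type*} [Fintype V] (G : SimpleGraph V)
    [DecidableRel G.Adj] (i : V) (hi : 0 < G.degree i) :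
    ∑ j, (if G.Adj i j then 1 / (G.degree i : ℝ) else 0) = 1 := by
  have hne : (G.degree i : ℝ) ≠ 0 := by positivity
  rw [← Finset.sum_filter, Finset.sum_const, ← SimpleGraph.neighborFinset_eq_filter,
    SimpleGraph.card_neighborFinset_eq_degree, nsmul_eq_mul, mul_one_div_cancel hne]

theorem abs_one_div_sub_one_div {a b : ℝ} (ha : 0 < a) (hb : 0 < b) :
    |1 / b - 1 / a| = 1 / b + 1 / a - 2 / max a b := by
  rcases le_total a b with h | h
  · rw [max_eq_right h, abs_of_nonpos (sub_nonpos.2 (one_div_le_one_div_of_le ha h))]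
    ring
  · rw [max_eq_left h, abs_of_nonneg (sub_nonneg.2 (one_div_le_one_div_of_le hb h))]
    ring

/-- For a simple connected graph on `n` vertices with Randić transition
matrix entries `r_{ij} = 1/d_i` if `i ∼ j` and `0` otherwise, and for distinct
non-adjacent vertices `i ≁ k`:
`∑_{j ≠ i,k} |r_{kj} - r_{ij}| = 2 - 2N(i,k)/max{d_i, d_k}`. -/
theorem randic_row_difference_sum_nonadjacent (n : ℕ)
    (G : SimpleGraph (Fin n)) [DecidableRel G.Adj]
    (hconn : G.Connected)
    (R : Matrix (Fin n) (Fin n) ℝ)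
    (hR : ∀ i j, R i j = if G.Adj i j then 1 / (G.degree i : ℝ) else 0)
    (i k : Fin n) (hik : i ≠ k) (hnadj : ¬ G.Adj i k) :
    ∑ j ∈ (Finset.univ.erase i).erase k, |R k j - R i j| =
      2 - 2 * ((G.neighborFinset i ∩ G.neighborFinset k).card : ℝ) /
          max (G.degree i : ℝ) (G.degree k : ℝ) := by
  have : Nontrivial (Fin n) := ⟨i, k, hik⟩
  have hi : 0 < G.degree i := hconn.preconnected.degree_pos_of_nontrivial i
  have hk : 0 < G.degree k := hconn.preconnected.degree_pos_of_nontrivial k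
  have hi' : (0 : ℝ) < G.degree i := by exact_mod_cast hi
  have hk' : (0 : ℝ) < G.degree k := by exact_mod_cast hk
  have hki : ¬ G.Adj k i := fun h => hnadj h.symm
  have hterm : ∀ j, |R k j - R i j| = R k j + R i j -
      if j ∈ G.neighborFinset i ∩ G.neighborFinset k then
        2 / max (G.degree i : ℝ) (G.degree k : ℝ) else 0 := by
    intro j
    by_cases h₁ : G.Adj i j <;> by_cases h₂ : G.Adj k j <;>
      simp only [hR, h₁, h₂, Finset.mem_inter, SimpleGraph.mem_neighborFinset, if_true, if_false,
        and_true, and_false, and_self]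
    · exact abs_one_div_sub_one_div hi' hk'
    · rw [zero_sub, abs_neg, abs_of_pos (one_div_pos.2 hi')]
      ring
    · rw [sub_zero, abs_of_pos (one_div_pos.2 hk')]
      ring
    · simp
  have hRsum : ∀ v, 0 < G.degree v → ∑ j, R v j = 1 := fun v hv => by
    simpa only [hR] using sum_one_div_degree_eq_one G v hv
  rw [Finset.sum_erase _ (by simp [hR, hnadj]), Finset.sum_erase _ (by simp [hR, hki])]
  simp_rw [hterm]
  rw [Finset.sum_sub_distrib, Finset.sum_add_distrib, hRsum k hk, hRsum i hi,
    Finset.sum_ite_mem, Finset.univ_inter, Finset.sum_const, nsmul_eq_mul]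
  ring
end
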